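/- Let a, b, c be complex numbers, none of which is an integer, with Re(c - a - b) > 0. Then Σ_{k=0}^∞ [(a)_k (b)_k (-1)^k / ((c)_k k!)] · [ψ(c+k) + ψ(1+k) - ψ(a+k) - ψ(b+k)] = π [cot(πa) + cot(πb) - cot(πc)] · Σ_{k=0}^∞ (a)_k (b)_k (-1)^k / ((c)_k k!) + ((1-c)/((1-a)(1-b))) · Σ_{k=0}^∞ k! (2-c)_k (-1)^k / ((2-a)_k (2-b)_k) + [π Γ(1-a) Γ(1-b) Γ(c-1) / (Γ(1-c) sin(πc) Γ(c-a) Γ(c-b))] · Σ_{k=0}^∞ (1-c+a)_k (1-c+b)_k (-1)^k / ((2-c)_k k!). All series converge absolutely. -/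

import Mathlib

open Complex Finset

noncomputable def ψ (z : ℂ) : ℂ := deriv Complex.Gamma z / Complex.Gamma z

noncomputable def rf (x : ℂ) (n : ℕ) : ℂ := ∏ j ∈ Finset.range n, (x + j)

open Filter Topology

theorem norm_betaIntegral_le {x α : ℂ} {n : ℕ} (hx : n + 1 ≤ x.re) (hα : 0 < α.re) :
    ‖betaIntegral x α‖ ≤ ‖betaIntegral α.re (n + 1)‖ := by
  have hconv := betaIntegral_convergent (u := (n : ℂ) + 1) (v := (α.re : ℂ))
    (by simp; positivity) (by simpa using hα)
  have hne : ∀ᵐ t : ℝ, t ≠ 1 := by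
    simp [MeasureTheory.ae_iff]
  have hnorm : ∀ t : ℝ, t ∈ Set.Ioo (0 : ℝ) 1 → ∀ u v : ℂ,
      ‖(t : ℂ) ^ (u - 1) * (1 - (t : ℂ)) ^ (v - 1)‖ = t ^ (u.re - 1) * (1 - t) ^ (v.re - 1) := by
    intro t ht u v
    rw [norm_mul, Complex.norm_cpow_eq_rpow_re_of_pos ht.1, ← ofReal_one, ← ofReal_sub,
      Complex.norm_cpow_eq_rpow_re_of_pos (sub_pos.2 ht.2)]
    simp
  calc ‖betaIntegral x α‖
      ≤ ∫ t : ℝ in 0..1, ‖(t : ℂ) ^ ((n : ℂ) + 1 - 1) * (1 - (t : ℂ)) ^ ((α.re : ℂ) - 1)‖ := by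
        refine intervalIntegral.norm_integral_le_of_norm_le zero_le_one ?_ hconv.norm
        filter_upwards [hne] with t ht1 ht
        have ht' : t ∈ Set.Ioo (0 : ℝ) 1 := ⟨ht.1, lt_of_le_of_ne ht.2 ht1⟩
        rw [hnorm t ht', hnorm t ht', ofReal_re]
        refine mul_le_mul_of_nonneg_right ?_ (Real.rpow_nonneg (sub_nonneg.2 ht.2) _)
        apply Real.rpow_le_rpow_of_exponent_ge ht.1 ht.2
        simp only [add_re, natCast_re, one_re]
        linarith
    _ = ‖betaIntegral (n + 1) α.re‖ := by
        have : betaIntegral (n + 1) α.re = ((∫ t : ℝ in 0..1,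
            ‖(t : ℂ) ^ ((n : ℂ) + 1 - 1) * (1 - (t : ℂ)) ^ ((α.re : ℂ) - 1)‖ : ℝ) : ℂ) := by
          rw [betaIntegral, ← intervalIntegral.integral_ofReal]
          refine intervalIntegral.integral_congr_ae ?_
          filter_upwards [hne] with t ht1 ht
          rw [Set.uIoc_of_le zero_le_one] at ht
          have ht' : t ∈ Set.Ioo (0 : ℝ) 1 := ⟨ht.1, lt_of_le_of_ne ht.2 ht1⟩
          rw [hnorm t ht', ofReal_mul, ofReal_cpow ht.1.le, ofReal_cpow (sub_nonneg.2 ht.2)]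
          simp
        rw [this, norm_real, Real.norm_of_nonneg]
        exact intervalIntegral.integral_nonneg zero_le_one fun t _ => norm_nonneg _
    _ = _ := by rw [betaIntegral_symm]

theorem exists_norm_betaIntegral_le {α : ℂ} (hα : 0 < α.re) :
    ∃ C, 0 ≤ C ∧ ∀ x : ℂ, 2 ≤ x.re → ‖betaIntegral x α‖ ≤ C * x.re ^ (-α.re) := by
  obtain ⟨C, hC⟩ := (GammaSeq_tendsto_Gamma (α.re : ℂ)).norm.bddAbove_range
  have hC0 : 0 ≤ C := (norm_nonneg _).trans (hC ⟨0, rfl⟩)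
  refine ⟨C * 3 ^ α.re, by positivity, fun x hx => ?_⟩
  obtain ⟨n, hn⟩ : ∃ n : ℕ, ⌊x.re⌋₊ = n + 1 :=
    Nat.exists_eq_add_of_le' ((Nat.one_le_floor_iff _).2 (by linarith))
  have h1 : (n : ℝ) + 1 ≤ x.re := by
    have := Nat.floor_le (show 0 ≤ x.re by linarith)
    rw [hn] at this; exact_mod_cast this
  have h2 : x.re < n + 2 := by
    have := Nat.lt_floor_add_one x.re
    rw [hn] at this; push_cast at this; linarith
  have hn0 : 0 < n := by
    have : (0 : ℝ) < n := by linarith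
    exact_mod_cast this
  have hn1 : (1 : ℝ) ≤ n := by exact_mod_cast hn0
  refine (norm_betaIntegral_le h1 hα).trans ?_
  have h3 : ‖GammaSeq (α.re : ℂ) n‖ ≤ C := hC ⟨n, rfl⟩
  rw [GammaSeq_eq_betaIntegral_of_re_pos (by simpa using hα), norm_mul,
    Complex.norm_natCast_cpow_of_pos hn0, ofReal_re] at h3
  have hnα : 0 < (n : ℝ) ^ α.re := Real.rpow_pos_of_pos (by linarith) _
  have hxα : 0 < x.re ^ α.re := Real.rpow_pos_of_pos (by linarith) _
  have h4 : x.re ^ α.re ≤ 3 ^ α.re * (n : ℝ) ^ α.re := by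
    rw [← Real.mul_rpow (by norm_num) (by linarith)]
    exact Real.rpow_le_rpow (by linarith) (by linarith) hα.le
  rw [Real.rpow_neg (by linarith), ← div_eq_mul_inv, le_div_iff₀ hxα]
  calc _ ≤ ‖betaIntegral α.re (n + 1)‖ * (3 ^ α.re * (n : ℝ) ^ α.re) := by gcongr
    _ = ((n : ℝ) ^ α.re * ‖betaIntegral α.re (n + 1)‖) * 3 ^ α.re := by ring
    _ ≤ _ := by gcongr

theorem exists_norm_Gamma_div_Gamma_add_le (α : ℂ) :
    ∃ (C : ℝ) (M : ℕ), 0 ≤ C ∧ ∀ x : ℂ, 2 ≤ x.re →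
      ‖Gamma x * (Gamma (x + α))⁻¹‖ ≤ C * (1 + |x.im|) ^ M * x.re ^ (-α.re) := by
  suffices ∀ (m : ℕ) (α : ℂ), 0 < α.re + m → ∃ (C : ℝ) (M : ℕ), 0 ≤ C ∧ ∀ x : ℂ, 2 ≤ x.re →
      ‖Gamma x * (Gamma (x + α))⁻¹‖ ≤ C * (1 + |x.im|) ^ M * x.re ^ (-α.re) by
    obtain ⟨m, hm⟩ := exists_nat_gt (-α.re)
    exact this m α (by linarith)
  intro m
  induction m with
  | zero =>
    intro α hα
    have hα : 0 < α.re := by simpa using hα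
    obtain ⟨C, hC0, hC⟩ := exists_norm_betaIntegral_le hα
    refine ⟨C * ‖(Gamma α)⁻¹‖, 0, by positivity, fun x hx => ?_⟩
    have hx0 : 0 < x.re := by linarith
    have h := Gamma_mul_Gamma_eq_betaIntegral hx0 hα
    have h1 : Gamma (x + α) ≠ 0 := Gamma_ne_zero_of_re_pos (by simp; linarith)
    have h2 : Gamma α ≠ 0 := Gamma_ne_zero_of_re_pos hα
    have : Gamma x * (Gamma (x + α))⁻¹ = betaIntegral x α * (Gamma α)⁻¹ := by
      field_simp
      linear_combination h
    rw [this, norm_mul]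
    have := hC x hx
    calc _ ≤ (C * x.re ^ (-α.re)) * ‖(Gamma α)⁻¹‖ := by gcongr
      _ = _ := by ring
  | succ m ih =>
    intro α hα
    obtain ⟨C, M, hC0, hC⟩ := ih (α + 1) (by simp; push_cast at hα; linarith)
    refine ⟨C * (1 + ‖α‖), M + 1, by positivity, fun x hx => ?_⟩
    have hx0 : 0 < x.re := by linarith
    rw [one_div_Gamma_eq_self_mul_one_div_Gamma_add_one (x + α), mul_left_comm, norm_mul, add_assoc]
    have h1 : ‖x + α‖ ≤ (1 + ‖α‖) * (1 + |x.im|) * x.re := by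
      have := norm_add_le x α
      have := norm_le_abs_re_add_abs_im x
      rw [abs_of_pos hx0] at this
      have h5 := abs_nonneg x.im
      have h6 := norm_nonneg α
      nlinarith [mul_nonneg h5 h6, mul_nonneg (mul_nonneg h5 h6) hx0.le, mul_nonneg h5 hx0.le,
        mul_nonneg h6 hx0.le]
    have h2 := hC x hx
    calc _ ≤ ((1 + ‖α‖) * (1 + |x.im|) * x.re) * (C * (1 + |x.im|) ^ M * x.re ^ (-(α + 1).re)) := by
          gcongr
      _ = (C * (1 + ‖α‖)) * (1 + |x.im|) ^ (M + 1) * (x.re * x.re ^ (-(α + 1).re)) := by ring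
      _ = _ := by
        congr 1
        nth_rewrite 1 [← Real.rpow_one x.re]
        rw [← Real.rpow_add hx0]
        congr 1
        simp

theorem rpow_le_two_rpow_abs_mul_rpow {x y : ℝ} (hx : 0 < x) (h1 : x / 2 ≤ y) (h2 : y ≤ 2 * x)
    (s : ℝ) : y ^ s ≤ 2 ^ |s| * x ^ s := by
  have hy : 0 < y := by linarith
  rcases le_total 0 s with hs | hs
  · rw [abs_of_nonneg hs, ← Real.mul_rpow (by norm_num) hx.le]
    exact Real.rpow_le_rpow hy.le h2 hs
  · rw [abs_of_nonpos hs, Real.rpow_neg (by norm_num), ← Real.inv_rpow (by norm_num),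
      ← Real.mul_rpow (by norm_num) hx.le]
    exact Real.rpow_le_rpow_of_nonpos (by positivity) (by linarith) hs

theorem exists_norm_Gamma_add_div_Gamma_add_le (β γ : ℂ) :
    ∃ (C : ℝ) (M : ℕ) (N : ℝ), 0 ≤ C ∧ ∀ z : ℂ, N ≤ z.re →
      ‖Gamma (z + β) * (Gamma (z + γ))⁻¹‖ ≤ C * (1 + |z.im|) ^ M * z.re ^ (β - γ).re := by
  obtain ⟨C, M, hC0, hC⟩ := exists_norm_Gamma_div_Gamma_add_le (γ - β)
  refine ⟨C * (1 + ‖β‖) ^ M * 2 ^ |(β - γ).re|, M, 2 * ‖β‖ + 4, by positivity, fun z hz => ?_⟩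
  have hβ := abs_le.1 (abs_re_le_norm β)
  have hβi := abs_im_le_norm β
  have hβ0 := norm_nonneg β
  have h := hC (z + β) (by simp only [add_re]; linarith)
  rw [show z + β + (γ - β) = z + γ by ring, show -(γ - β).re = (β - γ).re by simp] at h
  have him : 1 + |(z + β).im| ≤ (1 + ‖β‖) * (1 + |z.im|) := by
    rw [add_im]
    have := abs_add_le z.im β.im
    nlinarith [abs_nonneg z.im]
  have hre := rpow_le_two_rpow_abs_mul_rpow (x := z.re) (y := (z + β).re) (by linarith)
    (by simp only [add_re]; linarith) (by simp only [add_re]; linarith) (β - γ).re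
  have h0 : 0 ≤ (z + β).re ^ (β - γ).re := Real.rpow_nonneg (by simp only [add_re]; linarith) _
  calc _ ≤ C * (1 + |(z + β).im|) ^ M * (z + β).re ^ (β - γ).re := h
    _ ≤ C * ((1 + ‖β‖) * (1 + |z.im|)) ^ M * (2 ^ |(β - γ).re| * z.re ^ (β - γ).re) := by
      gcongr
    _ = _ := by rw [mul_pow]; ring

theorem norm_sin_le_exp_abs_im (w : ℂ) : ‖Complex.sin w‖ ≤ Real.exp |w.im| := by
  have h1 : ‖Complex.exp (-w * I)‖ ≤ Real.exp |w.im| := by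
    rw [Complex.norm_exp]
    apply Real.exp_le_exp.2
    simpa using le_abs_self w.im
  have h2 : ‖Complex.exp (w * I)‖ ≤ Real.exp |w.im| := by
    rw [Complex.norm_exp]
    apply Real.exp_le_exp.2
    simpa using neg_le_abs w.im
  rw [Complex.sin, norm_div, norm_mul, norm_I]
  have := norm_sub_le (Complex.exp (-w * I)) (Complex.exp (w * I))
  simp only [Complex.norm_ofNat]
  linarith

theorem norm_sin_pi_mul_le (p z : ℂ) :
    ‖Complex.sin (Real.pi * (p - z))‖ ≤
      Real.exp (Real.pi * |p.im|) * Real.exp (Real.pi * |z.im|) := by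
  refine (norm_sin_le_exp_abs_im _).trans ?_
  rw [← Real.exp_add]
  apply Real.exp_le_exp.2
  rw [im_ofReal_mul, abs_mul, abs_of_pos Real.pi_pos, ← mul_add]
  gcongr
  rw [sub_im]
  exact abs_sub _ _

theorem inv_Gamma_sub_eq {p z : ℂ} (h : p.re < z.re + 1) :
    (Gamma (p - z))⁻¹ = Gamma (z + (1 - p)) * (Complex.sin (Real.pi * (p - z)) / Real.pi) := by
  have h1 := Complex.Gamma_mul_Gamma_one_sub (p - z)
  rw [show 1 - (p - z) = z + (1 - p) by ring] at h1
  have h2 : Gamma (z + (1 - p)) ≠ 0 := Gamma_ne_zero_of_re_pos (by simp; linarith)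
  have hπ : (Real.pi : ℂ) ≠ 0 := ofReal_ne_zero.2 Real.pi_ne_zero
  by_cases hs : Complex.sin (Real.pi * (p - z)) = 0
  · rw [hs, div_zero] at h1
    rw [(mul_eq_zero.1 h1).resolve_right h2, hs]
    simp
  · have h3 : Gamma (p - z) ≠ 0 := by
      intro h0
      rw [h0, zero_mul] at h1
      exact div_ne_zero hπ hs h1.symm
    rw [eq_div_iff hs] at h1
    generalize Complex.sin (Real.pi * (p - z)) = S at *
    field_simp
    linear_combination -h1

/-- The product of reciprocal Gamma functions `1 / (Γ(p - z) Γ(q - z) Γ(r + z) Γ(t + z))`. -/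
noncomputable def recipGamma₄ (p q r t z : ℂ) : ℂ :=
  (Gamma (p - z))⁻¹ * (Gamma (q - z))⁻¹ * (Gamma (r + z))⁻¹ * (Gamma (t + z))⁻¹

theorem recipGamma₄_neg (p q r t z : ℂ) : recipGamma₄ p q r t (-z) = recipGamma₄ r t p q z := by
  simp only [recipGamma₄, sub_neg_eq_add, ← sub_eq_add_neg]
  ring

theorem differentiable_recipGamma₄ (p q r t : ℂ) : Differentiable ℂ (recipGamma₄ p q r t) :=
  (((differentiable_one_div_Gamma.comp (differentiable_id.const_sub p)).mul
    (differentiable_one_div_Gamma.comp (differentiable_id.const_sub q))).mul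
    (differentiable_one_div_Gamma.comp (differentiable_id.const_add r))).mul
    (differentiable_one_div_Gamma.comp (differentiable_id.const_add t))

theorem recipGamma₄_recurrence (p q r t z : ℂ) :
    (p - z - 1) * (q - z - 1) * recipGamma₄ p q r t z =
      (r + z) * (t + z) * recipGamma₄ p q r t (z + 1) := by
  have hp := one_div_Gamma_eq_self_mul_one_div_Gamma_add_one (p - z - 1)
  have hq := one_div_Gamma_eq_self_mul_one_div_Gamma_add_one (q - z - 1)
  have hr := one_div_Gamma_eq_self_mul_one_div_Gamma_add_one (r + z)
  have ht := one_div_Gamma_eq_self_mul_one_div_Gamma_add_one (t + z)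
  rw [sub_add_cancel] at hp hq
  rw [recipGamma₄, recipGamma₄, hr, ht, ← sub_sub, ← sub_sub, hp, hq, ← add_assoc, ← add_assoc]
  ring

theorem exists_norm_recipGamma₄_le_of_le_re (p q r t : ℂ) :
    ∃ (C : ℝ) (M : ℕ) (N : ℝ), 0 ≤ C ∧ ∀ z : ℂ, N ≤ z.re →
      ‖recipGamma₄ p q r t z‖ ≤ C * ((1 + |z.im|) ^ M * Real.exp (2 * Real.pi * |z.im|)) *
        z.re ^ (2 - (p + q + r + t).re) := by
  obtain ⟨C₁, M₁, N₁, hC₁, h₁⟩ := exists_norm_Gamma_add_div_Gamma_add_le (1 - p) r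
  obtain ⟨C₂, M₂, N₂, hC₂, h₂⟩ := exists_norm_Gamma_add_div_Gamma_add_le (1 - q) t
  refine ⟨C₁ * C₂ * (Real.exp (Real.pi * |p.im|) / Real.pi) *
    (Real.exp (Real.pi * |q.im|) / Real.pi), M₁ + M₂, max (max N₁ N₂) (max (max p.re q.re) 1),
    by have := Real.pi_pos; positivity, fun z hz => ?_⟩
  simp only [max_le_iff] at hz
  obtain ⟨⟨hz₁, hz₂⟩, ⟨hzp, hzq⟩, hz1⟩ := hz
  have hπ := Real.pi_pos
  have hz0 : 0 < z.re := by linarith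
  have e : recipGamma₄ p q r t z = (Gamma (z + (1 - p)) * (Gamma (z + r))⁻¹) *
      (Gamma (z + (1 - q)) * (Gamma (z + t))⁻¹) * (Complex.sin (Real.pi * (p - z)) / Real.pi) *
      (Complex.sin (Real.pi * (q - z)) / Real.pi) := by
    rw [recipGamma₄, inv_Gamma_sub_eq (by linarith : p.re < z.re + 1),
      inv_Gamma_sub_eq (by linarith : q.re < z.re + 1), add_comm r, add_comm t]
    ring
  rw [e, norm_mul, norm_mul, norm_mul, norm_div, norm_div, norm_real, Real.norm_of_nonneg hπ.le]
  have hp := norm_sin_pi_mul_le p z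
  have hq := norm_sin_pi_mul_le q z
  calc _ ≤ (C₁ * (1 + |z.im|) ^ M₁ * z.re ^ (1 - p - r).re) *
        (C₂ * (1 + |z.im|) ^ M₂ * z.re ^ (1 - q - t).re) *
        (Real.exp (Real.pi * |p.im|) * Real.exp (Real.pi * |z.im|) / Real.pi) *
        (Real.exp (Real.pi * |q.im|) * Real.exp (Real.pi * |z.im|) / Real.pi) := by
        gcongr
        · exact h₁ z hz₁
        · exact h₂ z hz₂
    _ = _ := by
      rw [show (2 - (p + q + r + t).re) = (1 - p - r).re + (1 - q - t).re by simp; ring,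
        Real.rpow_add hz0, show 2 * Real.pi * |z.im| = Real.pi * |z.im| + Real.pi * |z.im| by ring,
        Real.exp_add, pow_add]
      ring

theorem exists_norm_recipGamma₄_le_of_le_abs_re (p q r t : ℂ) :
    ∃ (C : ℝ) (M : ℕ) (N : ℝ), 0 ≤ C ∧ ∀ z : ℂ, N ≤ |z.re| →
      ‖recipGamma₄ p q r t z‖ ≤ C * ((1 + |z.im|) ^ M * Real.exp (2 * Real.pi * |z.im|)) *
        |z.re| ^ (2 - (p + q + r + t).re) := by
  obtain ⟨C₁, M₁, N₁, hC₁, h₁⟩ := exists_norm_recipGamma₄_le_of_le_re p q r t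
  obtain ⟨C₂, M₂, N₂, hC₂, h₂⟩ := exists_norm_recipGamma₄_le_of_le_re r t p q
  refine ⟨max C₁ C₂, max M₁ M₂, max N₁ N₂, le_max_of_le_left hC₁, fun z hz => ?_⟩
  rw [max_le_iff] at hz
  have hy : 1 ≤ 1 + |z.im| := by linarith [abs_nonneg z.im]
  rcases le_total 0 z.re with hre | hre
  · rw [abs_of_nonneg hre] at hz ⊢
    refine (h₁ z hz.1).trans ?_
    gcongr
    · exact le_max_left _ _
    · exact le_max_left _ _
  · rw [abs_of_nonpos hre] at hz ⊢
    have := h₂ (-z) (by simpa using hz.2)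
    rw [recipGamma₄_neg, neg_im, abs_neg, neg_re] at this
    refine this.trans ?_
    rw [show (2 - (r + t + p + q).re) = 2 - (p + q + r + t).re by simp; ring]
    have : 0 ≤ -z.re := by linarith
    gcongr
    · exact le_max_right _ _
    · exact le_max_right _ _

theorem exists_norm_recipGamma₄_le_add_one (p q r t : ℂ) :
    ∃ K Y : ℝ, 0 ≤ K ∧ ∀ z : ℂ, Y ≤ |z.im| →
      ‖recipGamma₄ p q r t z‖ ≤ K * ‖recipGamma₄ p q r t (z + 1)‖ := by
  refine ⟨(1 + ‖p + r - 1‖) * (1 + ‖q + t - 1‖), 1 + |p.im| + |q.im|, by positivity,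
    fun z hz => ?_⟩
  have key : ∀ p r : ℂ, 1 + |p.im| ≤ |z.im| →
      1 ≤ ‖p - z - 1‖ ∧ ‖r + z‖ ≤ (1 + ‖p + r - 1‖) * ‖p - z - 1‖ := by
    intro p r h
    have h1 : 1 ≤ ‖p - z - 1‖ := by
      refine le_trans ?_ (abs_im_le_norm _)
      simp only [sub_im, one_im, sub_zero]
      have := abs_sub_abs_le_abs_sub z.im p.im
      rw [abs_sub_comm] at this
      linarith
    refine ⟨h1, ?_⟩
    have : r + z = (p + r - 1) - (p - z - 1) := by ring
    have h2 := norm_sub_le (p + r - 1) (p - z - 1)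
    rw [← this] at h2
    nlinarith [norm_nonneg (p + r - 1)]
  obtain ⟨hp1, hp2⟩ := key p r (by linarith [abs_nonneg q.im])
  obtain ⟨hq1, hq2⟩ := key q t (by linarith [abs_nonneg p.im])
  have h := congrArg norm (recipGamma₄_recurrence p q r t z)
  simp only [norm_mul] at h
  have hpos : 0 < ‖p - z - 1‖ * ‖q - z - 1‖ := by positivity
  refine le_of_mul_le_mul_left ?_ hpos
  rw [h]
  calc _ ≤ ((1 + ‖p + r - 1‖) * ‖p - z - 1‖) * ((1 + ‖q + t - 1‖) * ‖q - z - 1‖) *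
        ‖recipGamma₄ p q r t (z + 1)‖ := by gcongr
    _ = _ := by ring

theorem exists_norm_recipGamma₄_le_of_le_abs_im (p q r t : ℂ) (h : 2 ≤ (p + q + r + t).re) :
    ∃ (C : ℝ) (M : ℕ) (Y : ℝ), 0 ≤ C ∧ ∀ z : ℂ, Y ≤ |z.im| →
      ‖recipGamma₄ p q r t z‖ ≤ C * ((1 + |z.im|) ^ M * Real.exp (2 * Real.pi * |z.im|)) := by
  obtain ⟨C, M, N, hC0, hC⟩ := exists_norm_recipGamma₄_le_of_le_abs_re p q r t
  obtain ⟨K, Y, hK0, hK⟩ := exists_norm_recipGamma₄_le_add_one p q r t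
  have hfar : ∀ z : ℂ, max N 1 ≤ |z.re| → ‖recipGamma₄ p q r t z‖ ≤
      C * ((1 + |z.im|) ^ M * Real.exp (2 * Real.pi * |z.im|)) := by
    intro z hz
    rw [max_le_iff] at hz
    refine (hC z hz.1).trans (mul_le_of_le_one_right (by positivity) ?_)
    exact Real.rpow_le_one_of_one_le_of_nonpos hz.2 (by linarith)
  have hshift : ∀ (n : ℕ) (z : ℂ), Y ≤ |z.im| →
      ‖recipGamma₄ p q r t z‖ ≤ K ^ n * ‖recipGamma₄ p q r t (z + n)‖ := by
    intro n
    induction n with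
    | zero => intro z _; simp
    | succ n ih =>
      intro z hz
      refine (ih z hz).trans ?_
      have := hK (z + n) (by simpa using hz)
      rw [pow_succ, mul_assoc, Nat.cast_succ, ← add_assoc]
      gcongr
  obtain ⟨n, hn⟩ := exists_nat_ge (2 * max N 1)
  refine ⟨max 1 (K ^ n) * C, M, Y, by positivity, fun z hz => ?_⟩
  rcases le_or_gt (max N 1) |z.re| with hz' | hz'
  · refine (hfar z hz').trans ?_
    gcongr
    exact le_mul_of_one_le_left hC0 (le_max_left _ _)
  · refine (hshift n z hz).trans ?_
    have h1 := hfar (z + n) (by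
      simp only [add_re, natCast_re]
      exact le_trans (by linarith [(abs_lt.1 hz').1]) (le_abs_self _))
    simp only [add_im, natCast_im, add_zero] at h1
    rw [mul_assoc]
    gcongr
    exact le_max_right _ _

theorem eq_zero_of_antiperiodic_of_norm_le (M : ℕ) {G : ℂ → ℂ} (hG : Differentiable ℂ G)
    (hper : ∀ s, G (s + 1) = -G s) {C : ℝ} (hC : ∀ s, ‖G s‖ ≤ C * (1 + ‖s‖) ^ M) :
    ∀ s, G s = 0 := by
  have hconst : (∀ x y, G x = G y) → ∀ s, G s = 0 := by
    intro h s
    have := hper s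
    rw [h (s + 1) s] at this
    exact self_eq_neg.1 this
  induction M generalizing G C with
  | zero =>
    refine hconst (hG.apply_eq_apply_of_bounded ?_)
    refine isBounded_iff_forall_norm_le.2 ⟨C, ?_⟩
    rintro _ ⟨s, rfl⟩
    simpa using hC s
  | succ M ih =>
    have hC0 : 0 ≤ C := by
      have := (norm_nonneg _).trans (hC 0)
      simpa using this
    have hd : ∀ s, deriv G s = 0 := by
      have hper' : ∀ s, deriv G (s + 1) = -deriv G s := by
        intro s
        rw [← deriv_comp_add_const, ← deriv.fun_neg]
        simp only [hper]
      refine ih (C := C * 2 ^ (M + 1)) ?_ hper' ?_ ?_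
      · exact (hG.contDiff (n := 2)).differentiable_deriv_two
      · intro s
        have hR : 0 < 1 + ‖s‖ := by positivity
        have := norm_deriv_le_of_forall_mem_sphere_norm_le (c := s) (R := 1 + ‖s‖)
          (C := C * (2 * (1 + ‖s‖)) ^ (M + 1)) (f := G) hR hG.diffContOnCl (by
            intro z hz
            refine (hC z).trans ?_
            have h1 : ‖z‖ ≤ ‖s‖ + (1 + ‖s‖) := by
              have h2 := norm_add_le s (z - s)
              rw [mem_sphere_iff_norm.1 hz, add_sub_cancel] at h2
              exact h2
            gcongr
            linarith)
        refine this.trans (le_of_eq ?_)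
        rw [mul_pow, pow_succ (1 + ‖s‖)]
        field_simp
      · intro h s
        have := hper' s
        rw [h (s + 1) s] at this
        exact self_eq_neg.1 this
    exact hconst (is_const_of_deriv_eq_zero hG hd)

theorem exists_differentiable_eq_mul {D S : ℂ → ℂ} (hD : Differentiable ℂ D)
    (hS : Differentiable ℂ S) (h0 : ∀ z, S z = 0 → D z = 0) (h1 : ∀ z, S z = 0 → deriv S z ≠ 0) :
    ∃ G : ℂ → ℂ, Differentiable ℂ G ∧ ∀ z, D z = G z * S z := by
  classical
  refine ⟨fun z => if S z = 0 then deriv D z / deriv S z else D z / S z, fun z => ?_, fun z => ?_⟩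
  · by_cases hz : S z = 0
    · have hdD : Differentiable ℂ (dslope D z) := by
        rw [← differentiableOn_univ] at hD ⊢
        exact (differentiableOn_dslope Filter.univ_mem).2 hD
      have hdS : Differentiable ℂ (dslope S z) := by
        rw [← differentiableOn_univ] at hS ⊢
        exact (differentiableOn_dslope Filter.univ_mem).2 hS
      have hne : dslope S z z ≠ 0 := by
        rw [dslope_same]; exact h1 z hz
      refine ((hdD z).div (hdS z) hne).congr_of_eventuallyEq ?_
      filter_upwards [hdS.continuous.continuousAt.eventually_ne hne] with w hw
      by_cases hwz : w = z
      · subst hwz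
        simp [hz]
      · have hsub : w - z ≠ 0 := sub_ne_zero.2 hwz
        have eS := sub_smul_dslope S z w
        have eD := sub_smul_dslope D z w
        rw [hz, sub_zero, smul_eq_mul] at eS
        rw [h0 z hz, sub_zero, smul_eq_mul] at eD
        have hSw : S w ≠ 0 := by
          rw [← eS]; exact mul_ne_zero hsub hw
        rw [if_neg hSw, ← eS, ← eD, Pi.div_apply, mul_div_mul_left _ _ hsub]
    · refine ((hD z).div (hS z) hz).congr_of_eventuallyEq ?_
      filter_upwards [hS.continuous.continuousAt.eventually_ne hz] with w hw
      simp [hw]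
  · by_cases hz : S z = 0
    · simp [hz, h0 z hz]
    · simp [hz]

theorem exp_le_four_mul_norm_sin {w : ℂ} (hw : 1 ≤ |w.im|) :
    Real.exp |w.im| ≤ 4 * ‖Complex.sin w‖ := by
  have key : ∀ u v : ℂ, ‖v‖ = Real.exp (-|w.im|) → ‖u‖ = Real.exp |w.im| →
      Real.exp |w.im| ≤ 4 * (‖u - v‖ / 2) := by
    intro u v hv hu
    have h1 := norm_sub_norm_le u v
    have h2 : Real.exp (-|w.im|) ≤ 1 := Real.exp_le_one_iff.2 (by linarith)
    have h3 := Real.add_one_le_exp |w.im|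
    rw [hv, hu] at h1
    linarith
  have hs : ‖Complex.sin w‖ = ‖Complex.exp (-w * I) - Complex.exp (w * I)‖ / 2 := by
    rw [Complex.sin, norm_div, norm_mul, norm_I]
    simp
  rw [hs]
  rcases le_total 0 w.im with h | h
  · exact key _ _ (by simp [Complex.norm_exp, abs_of_nonneg h])
      (by simp [Complex.norm_exp, abs_of_nonneg h])
  · rw [norm_sub_rev]
    exact key _ _ (by simp [Complex.norm_exp, abs_of_nonpos h])
      (by simp [Complex.norm_exp, abs_of_nonpos h])

theorem apply_int_eq_zero_of_antiperiodic {D : ℂ → ℂ} (hper : ∀ s, D (s + 1) = -D s) {s : ℂ}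
    (hs : D s = 0) (n : ℤ) : D (s + n) = 0 := by
  induction n with
  | zero => simpa using hs
  | succ n ih =>
    push_cast at ih ⊢
    rw [← add_assoc, hper, ih, neg_zero]
  | pred n ih =>
    push_cast at ih ⊢
    have := hper (s + (-n - 1))
    rw [show s + (-(n : ℂ) - 1) + 1 = s + -n by ring, ih] at this
    simpa using this.symm

theorem exists_norm_le_of_antiperiodic {G : ℂ → ℂ} (hG : Continuous G)
    (hper : ∀ s, G (s + 1) = -G s) {C Y : ℝ} {M : ℕ} (hC0 : 0 ≤ C)
    (hC : ∀ s : ℂ, s.re ∈ Set.Icc (0 : ℝ) 1 → Y ≤ |s.im| → ‖G s‖ ≤ C * (1 + |s.im|) ^ M) :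
    ∃ C', ∀ s, ‖G s‖ ≤ C' * (1 + ‖s‖) ^ M := by
  have hcpt : IsCompact (Set.Icc (0 : ℝ) 1 ×ℂ Set.Icc (-Y) Y) :=
    isCompact_Icc.reProdIm isCompact_Icc
  obtain ⟨B, hB⟩ := hcpt.exists_bound_of_continuousOn hG.continuousOn
  have hnorm : Function.Periodic (fun s => ‖G s‖) 1 := fun s => by simp [hper]
  have hstrip : ∀ s : ℂ, s.re ∈ Set.Icc (0 : ℝ) 1 → ‖G s‖ ≤ (C + |B|) * (1 + |s.im|) ^ M := by
    intro s hs
    have h1 : (1 : ℝ) ≤ (1 + |s.im|) ^ M := one_le_pow₀ (by linarith [abs_nonneg s.im])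
    rcases le_total Y |s.im| with h | h
    · refine (hC s hs h).trans ?_
      gcongr
      linarith [abs_nonneg B]
    · have := hB s (mem_reProdIm.2 ⟨hs, abs_le.1 h⟩)
      nlinarith [abs_nonneg B, le_abs_self B]
  refine ⟨C + |B|, fun s => ?_⟩
  have h := hstrip (s - (⌊s.re⌋ : ℤ)) (by
    simp only [sub_re, intCast_re]
    exact ⟨by linarith [Int.floor_le s.re], by linarith [Int.lt_floor_add_one s.re]⟩)
  have h2 : ‖G (s - (⌊s.re⌋ : ℤ))‖ = ‖G s‖ := by
    simpa using hnorm.sub_int_mul_eq (x := s) ⌊s.re⌋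
  rw [h2] at h
  refine h.trans ?_
  simp only [sub_im, intCast_im, sub_zero]
  gcongr
  exact abs_im_le_norm s

theorem eq_of_antiperiodic_of_norm_le {E : ℂ → ℂ} (hE : Differentiable ℂ E)
    (hper : ∀ s, E (s + 1) = -E s) {C Y : ℝ} {M : ℕ}
    (hC : ∀ s : ℂ, s.re ∈ Set.Icc (0 : ℝ) 1 → Y ≤ |s.im| →
      ‖E s‖ ≤ C * ((1 + |s.im|) ^ M * Real.exp (2 * Real.pi * |s.im|))) (s : ℂ) :
    E s = E 0 * Complex.cos (Real.pi * s) + E (1 / 2) * Complex.sin (Real.pi * s) := by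
  have hπ : (Real.pi : ℂ) ≠ 0 := ofReal_ne_zero.2 Real.pi_ne_zero
  have hπ0 := Real.pi_pos
  set D : ℂ → ℂ := fun s =>
    E s - (E 0 * Complex.cos (Real.pi * s) + E (1 / 2) * Complex.sin (Real.pi * s)) with hDdef
  set S : ℂ → ℂ := fun s => Complex.sin (2 * Real.pi * s) with hSdef
  have hD : Differentiable ℂ D := by
    simp only [hDdef]
    fun_prop
  have hS : Differentiable ℂ S := by
    simp only [hSdef]
    fun_prop
  have hDper : ∀ s, D (s + 1) = -D s := by
    intro s
    simp only [hDdef, hper, mul_add, mul_one, Complex.sin_add_pi, Complex.cos_add_pi]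
    ring
  have hSper : ∀ s, S (s + 1) = S s := by
    intro s
    simp only [hSdef, mul_add, mul_one, Complex.sin_add_two_pi]
  have hD0 : D 0 = 0 := by simp [hDdef]
  have hDhalf : D (1 / 2) = 0 := by
    simp only [hDdef]
    rw [show (Real.pi : ℂ) * (1 / 2) = Real.pi / 2 by ring, Complex.cos_pi_div_two,
      Complex.sin_pi_div_two]
    ring
  have hhalf : ∀ z, S z = 0 → ∃ k : ℤ, z = k / 2 := by
    intro z hz
    obtain ⟨k, hk⟩ := Complex.sin_eq_zero_iff.1 hz
    have h1 : (Real.pi : ℂ) * (2 * z - k) = 0 := by linear_combination hk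
    exact ⟨k, by linear_combination (mul_eq_zero.1 h1).resolve_left hπ / 2⟩
  have hzero : ∀ z, S z = 0 → D z = 0 := by
    intro z hz
    obtain ⟨k, hk'⟩ := hhalf z hz
    rcases Int.even_or_odd' k with ⟨n, rfl | rfl⟩
    · rw [hk', show ((2 * n : ℤ) : ℂ) / 2 = 0 + n by push_cast; ring]
      exact apply_int_eq_zero_of_antiperiodic hDper hD0 n
    · rw [hk', show ((2 * n + 1 : ℤ) : ℂ) / 2 = 1 / 2 + n by push_cast; ring]
      exact apply_int_eq_zero_of_antiperiodic hDper hDhalf n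
  have hSderiv : ∀ z, deriv S z = 2 * Real.pi * Complex.cos (2 * Real.pi * z) := by
    intro z
    have : HasDerivAt S (Complex.cos (2 * Real.pi * z) * (2 * Real.pi * 1)) z :=
      ((hasDerivAt_id z).const_mul (2 * (Real.pi : ℂ))).csin
    rw [this.deriv]
    ring
  have hsimple : ∀ z, S z = 0 → deriv S z ≠ 0 := by
    intro z hz h
    rw [hSderiv] at h
    have h1 := (mul_eq_zero.1 h).resolve_left (mul_ne_zero two_ne_zero hπ)
    have h2 := Complex.sin_sq_add_cos_sq (2 * Real.pi * z)
    rw [h1, show Complex.sin (2 * Real.pi * z) = 0 from hz] at h2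
    norm_num at h2
  obtain ⟨G, hG, hDG⟩ := exists_differentiable_eq_mul hD hS hzero hsimple
  have hGper : ∀ s, G (s + 1) = -G s := by
    have hcount : {z | S z = 0}.Countable := by
      refine (Set.countable_range fun k : ℤ => (k / 2 : ℂ)).mono fun z hz => ?_
      obtain ⟨k, hk⟩ := hhalf z hz
      exact ⟨k, hk.symm⟩
    refine congrFun (Continuous.ext_on (hcount.dense_compl ℂ)
      (hG.continuous.comp (continuous_add_const 1)) hG.continuous.neg fun z hz => ?_)
    have h1 := hDper z
    rw [hDG, hDG, hSper, ← neg_mul] at h1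
    exact mul_right_cancel₀ hz h1
  have him : ∀ s : ℂ, |(2 * Real.pi * s : ℂ).im| = 2 * Real.pi * |s.im| := by
    intro s
    rw [show (2 * Real.pi * s : ℂ) = ((2 * Real.pi : ℝ) : ℂ) * s by push_cast; ring,
      im_ofReal_mul, abs_mul, abs_of_pos (by positivity)]
  obtain ⟨C', hC'⟩ := exists_norm_le_of_antiperiodic (Y := max Y 1) (M := M)
    (C := 4 * (|C| + ‖E 0‖ + ‖E (1 / 2)‖)) hG.continuous hGper (by positivity) (by
      intro s hs hY
      rw [max_le_iff] at hY
      have h1 : 1 ≤ (1 + |s.im|) ^ M := one_le_pow₀ (by linarith)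
      have hsin : Real.exp (2 * Real.pi * |s.im|) ≤ 4 * ‖S s‖ := by
        have := exp_le_four_mul_norm_sin (w := 2 * Real.pi * s)
          (by rw [him]; nlinarith [Real.pi_gt_three])
        rwa [him] at this
      have hexp : Real.exp |(Real.pi * s : ℂ).im| ≤ Real.exp (2 * Real.pi * |s.im|) := by
        apply Real.exp_le_exp.2
        rw [im_ofReal_mul, abs_mul, abs_of_pos hπ0]
        nlinarith [abs_nonneg s.im]
      have hDs : ‖D s‖ ≤ (|C| + ‖E 0‖ + ‖E (1 / 2)‖) *
          ((1 + |s.im|) ^ M * Real.exp (2 * Real.pi * |s.im|)) := by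
        have hexpM : Real.exp |(Real.pi * s : ℂ).im| ≤
            (1 + |s.im|) ^ M * Real.exp (2 * Real.pi * |s.im|) :=
          hexp.trans (le_mul_of_one_le_left (Real.exp_pos _).le h1)
        have hcos : ‖Complex.cos (Real.pi * s)‖ ≤ Real.exp |(Real.pi * s : ℂ).im| := by
          rw [← Complex.sin_pi_div_two_sub]
          refine (norm_sin_le_exp_abs_im _).trans (le_of_eq ?_)
          rw [sub_im, show ((Real.pi : ℂ) / 2).im = 0 by simp, zero_sub, abs_neg]
        have hsin' := norm_sin_le_exp_abs_im (Real.pi * s)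
        calc ‖D s‖ ≤ ‖E s‖ + (‖E 0‖ * ‖Complex.cos (Real.pi * s)‖ +
              ‖E (1 / 2)‖ * ‖Complex.sin (Real.pi * s)‖) := by
              rw [← norm_mul, ← norm_mul]
              exact (norm_sub_le _ _).trans (by gcongr; exact norm_add_le _ _)
          _ ≤ |C| * ((1 + |s.im|) ^ M * Real.exp (2 * Real.pi * |s.im|)) +
              (‖E 0‖ * ((1 + |s.im|) ^ M * Real.exp (2 * Real.pi * |s.im|)) +
              ‖E (1 / 2)‖ * ((1 + |s.im|) ^ M * Real.exp (2 * Real.pi * |s.im|))) := by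
              gcongr
              · refine (hC s hs hY.1).trans ?_
                gcongr
                exact le_abs_self C
              · exact hcos.trans hexpM
              · exact hsin'.trans hexpM
          _ = _ := by ring
      rw [hDG, norm_mul] at hDs
      have hpos := Real.exp_pos (2 * Real.pi * |s.im|)
      refine le_of_mul_le_mul_right ?_ hpos
      calc ‖G s‖ * Real.exp (2 * Real.pi * |s.im|) ≤ ‖G s‖ * (4 * ‖S s‖) := by gcongr
        _ = 4 * (‖G s‖ * ‖S s‖) := by ring
        _ ≤ 4 * ((|C| + ‖E 0‖ + ‖E (1 / 2)‖) *
          ((1 + |s.im|) ^ M * Real.exp (2 * Real.pi * |s.im|))) := by gcongr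
        _ = _ := by ring)
  have hG0 := eq_zero_of_antiperiodic_of_norm_le M hG hGper hC' s
  have := hDG s
  rw [hG0, zero_mul] at this
  exact sub_eq_zero.1 this

theorem exists_summable_bound {X : Type*} {A : Set X} {f : ℤ → X → ℝ} {σ C N : ℝ} (hσ : 1 < σ)
    (h₁ : ∀ k : ℤ, N ≤ |(k : ℝ)| → ∀ x ∈ A, f k x ≤ C * |(k : ℝ)| ^ (-σ))
    (h₂ : ∀ k : ℤ, ∃ c, ∀ x ∈ A, f k x ≤ c) :
    ∃ u : ℤ → ℝ, Summable u ∧ ∀ k, ∀ x ∈ A, f k x ≤ u k := by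
  classical
  choose c hc using h₂
  refine ⟨fun k => if N ≤ |(k : ℝ)| then C * |(k : ℝ)| ^ (-σ) else c k, ?_, fun k x hx => ?_⟩
  · refine (summable_congr_cofinite ?_).1 ((Real.summable_abs_int_rpow hσ).mul_left C)
    refine (Set.finite_Icc (-⌈N⌉) ⌈N⌉).subset fun k hk => ?_
    have hk : ¬ N ≤ |(k : ℝ)| := fun h => hk (if_pos h).symm
    have : ((|k| : ℤ) : ℝ) ≤ (⌈N⌉ : ℤ) := by
      push_cast
      exact (not_le.1 hk).le.trans (Int.le_ceil N)
    exact abs_le.1 (by exact_mod_cast this)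
  · by_cases h : N ≤ |(k : ℝ)|
    · simpa [h] using h₁ k h x hx
    · simpa [h] using hc k x hx

theorem exists_norm_recipGamma₄_add_int_le (p q r t : ℂ) (R : ℝ) :
    ∃ (C : ℝ) (M : ℕ) (N : ℝ), 0 ≤ C ∧ ∀ k : ℤ, N ≤ |(k : ℝ)| → ∀ s : ℂ, |s.re| ≤ R →
      ‖recipGamma₄ p q r t (s + k)‖ ≤
        C * ((1 + |s.im|) ^ M * Real.exp (2 * Real.pi * |s.im|)) *
        |(k : ℝ)| ^ (2 - (p + q + r + t).re) := by
  obtain ⟨C, M, N, hC0, hC⟩ := exists_norm_recipGamma₄_le_of_le_abs_re p q r t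
  refine ⟨C * 2 ^ |2 - (p + q + r + t).re|, M, max (2 * N) (2 * |R| + 1), by positivity,
    fun k hk s hs => ?_⟩
  rw [max_le_iff] at hk
  have hR := le_abs_self R
  have hR0 := abs_nonneg R
  have h1 : |(k : ℝ)| / 2 ≤ |s.re + k| := by
    have := abs_sub_abs_le_abs_sub (k : ℝ) (-s.re)
    rw [abs_neg, sub_neg_eq_add, add_comm (k : ℝ)] at this
    linarith [hk.2]
  have h2 : |s.re + k| ≤ 2 * |(k : ℝ)| := (abs_add_le _ _).trans (by linarith [hk.2])
  have h := hC (s + k) (by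
    simp only [add_re, intCast_re]
    linarith [hk.1])
  rw [add_re s, intCast_re, add_im, intCast_im, add_zero] at h
  refine h.trans ?_
  have := rpow_le_two_rpow_abs_mul_rpow (by linarith [hk.2]) h1 h2 (2 - (p + q + r + t).re)
  simp only [add_re] at this ⊢
  calc _ ≤ C * ((1 + |s.im|) ^ M * Real.exp (2 * Real.pi * |s.im|)) *
      (2 ^ |2 - (p.re + q.re + r.re + t.re)| * |(k : ℝ)| ^ (2 - (p.re + q.re + r.re + t.re))) := by
        gcongr
    _ = _ := by ring

theorem norm_neg_one_zpow_mul (k : ℤ) (z : ℂ) : ‖(-1 : ℂ) ^ k * z‖ = ‖z‖ := by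
  rw [norm_mul, norm_zpow, norm_neg, norm_one, one_zpow, one_mul]

/-- The alternating bilateral series `∑ (-1) ^ k / (Γ(p-s-k) Γ(q-s-k) Γ(r+s+k) Γ(t+s+k))`. -/
noncomputable def altSum₄ (p q r t s : ℂ) : ℂ :=
  ∑' k : ℤ, (-1 : ℂ) ^ k * recipGamma₄ p q r t (s + k)

theorem altSum₄_add_one (p q r t s : ℂ) : altSum₄ p q r t (s + 1) = -altSum₄ p q r t s := by
  rw [altSum₄, altSum₄, ← tsum_neg, ← (Equiv.addRight (1 : ℤ)).tsum_eq (fun k : ℤ =>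
    -((-1 : ℂ) ^ k * recipGamma₄ p q r t (s + k)))]
  refine tsum_congr fun k => ?_
  simp only [Equiv.coe_addRight]
  rw [zpow_add_one₀ (by norm_num)]
  push_cast
  rw [show s + 1 + (k : ℂ) = s + (k + 1) by ring]
  ring

theorem exists_summable_bound_ball {p q r t : ℂ} (h : 3 < (p + q + r + t).re) (R : ℝ) :
    ∃ u : ℤ → ℝ, Summable u ∧ ∀ k : ℤ, ∀ s ∈ Metric.ball (0 : ℂ) R,
      ‖(-1 : ℂ) ^ k * recipGamma₄ p q r t (s + k)‖ ≤ u k := by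
  obtain ⟨C, M, N, hC0, hC⟩ := exists_norm_recipGamma₄_add_int_le p q r t R
  refine exists_summable_bound (σ := (p + q + r + t).re - 2) (N := N)
    (C := C * ((1 + |R|) ^ M * Real.exp (2 * Real.pi * |R|))) (by linarith)
    (fun k hk s hs => ?_) (fun k => ?_)
  · rw [mem_ball_zero_iff] at hs
    rw [norm_neg_one_zpow_mul, neg_sub]
    refine (hC k hk s ((abs_re_le_norm s).trans hs.le)).trans ?_
    have h1 : |s.im| ≤ |R| := (abs_im_le_norm s).trans (hs.le.trans (le_abs_self R))
    have := Real.pi_pos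
    gcongr
  · obtain ⟨c, hc⟩ := (isCompact_closedBall (0 : ℂ) R).exists_bound_of_continuousOn
      (((differentiable_recipGamma₄ p q r t).continuous.comp
        (continuous_add_const (k : ℂ))).continuousOn)
    exact ⟨c, fun s hs => by
      rw [norm_neg_one_zpow_mul]
      exact hc s (Metric.ball_subset_closedBall hs)⟩

theorem exists_summable_bound_strip {p q r t : ℂ} (h : 3 < (p + q + r + t).re) :
    ∃ (M : ℕ) (Y : ℝ) (u : ℤ → ℝ), Summable u ∧ ∀ s : ℂ, s.re ∈ Set.Icc (0 : ℝ) 1 → Y ≤ |s.im| →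
      ∀ k : ℤ, ‖(-1 : ℂ) ^ k * recipGamma₄ p q r t (s + k)‖ ≤
        u k * ((1 + |s.im|) ^ M * Real.exp (2 * Real.pi * |s.im|)) := by
  obtain ⟨C₁, M₁, N, hC₁, h₁⟩ := exists_norm_recipGamma₄_add_int_le p q r t 1
  obtain ⟨C₂, M₂, Y, hC₂, h₂⟩ := exists_norm_recipGamma₄_le_of_le_abs_im p q r t (by linarith)
  have hpos : ∀ s : ℂ, 0 < (1 + |s.im|) ^ max M₁ M₂ * Real.exp (2 * Real.pi * |s.im|) :=
    fun s => by positivity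
  obtain ⟨u, hu, hle⟩ := exists_summable_bound (σ := (p + q + r + t).re - 2) (N := N) (C := C₁)
    (A := {s : ℂ | s.re ∈ Set.Icc (0 : ℝ) 1 ∧ Y ≤ |s.im|})
    (f := fun k s => ‖(-1 : ℂ) ^ k * recipGamma₄ p q r t (s + k)‖ /
      ((1 + |s.im|) ^ max M₁ M₂ * Real.exp (2 * Real.pi * |s.im|))) (by linarith)
    (fun k hk s hs => by
      have hy : 1 ≤ 1 + |s.im| := by linarith [abs_nonneg s.im]
      rw [norm_neg_one_zpow_mul, div_le_iff₀ (hpos s), neg_sub]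
      refine (h₁ k hk s (abs_le.2 ⟨by linarith [hs.1.1], hs.1.2⟩)).trans ?_
      rw [mul_right_comm]
      gcongr
      exact le_max_left _ _)
    (fun k => ⟨C₂, fun s hs => by
      have hy : 1 ≤ 1 + |s.im| := by linarith [abs_nonneg s.im]
      have := h₂ (s + k) (by simpa using hs.2)
      simp only [add_im, intCast_im, add_zero] at this
      rw [norm_neg_one_zpow_mul, div_le_iff₀ (hpos s)]
      refine this.trans ?_
      gcongr
      exact le_max_right _ _⟩)
  exact ⟨max M₁ M₂, Y, u, hu, fun s hs hY k => (div_le_iff₀ (hpos s)).1 (hle k s ⟨hs, hY⟩)⟩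

theorem differentiable_altSum₄_term (p q r t : ℂ) (k : ℤ) :
    Differentiable ℂ fun s => (-1 : ℂ) ^ k * recipGamma₄ p q r t (s + k) :=
  ((differentiable_recipGamma₄ p q r t).comp (differentiable_id.add_const (k : ℂ))).const_mul _

theorem differentiable_altSum₄ {p q r t : ℂ} (h : 3 < (p + q + r + t).re) :
    Differentiable ℂ (altSum₄ p q r t) := by
  intro s
  obtain ⟨u, hu, hle⟩ := exists_summable_bound_ball h (‖s‖ + 1)
  exact (differentiableOn_tsum_of_summable_norm hu
    (fun k => (differentiable_altSum₄_term p q r t k).differentiableOn) Metric.isOpen_ball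
    hle).differentiableAt (Metric.isOpen_ball.mem_nhds (by simp))

theorem hasSum_deriv_altSum₄ {p q r t : ℂ} (h : 3 < (p + q + r + t).re) (s : ℂ) :
    HasSum (fun k : ℤ => (-1 : ℂ) ^ k * deriv (recipGamma₄ p q r t) (s + k))
      (deriv (altSum₄ p q r t) s) := by
  obtain ⟨u, hu, hle⟩ := exists_summable_bound_ball h (‖s‖ + 1)
  have := hasSum_deriv_of_summable_norm hu
    (fun k => (differentiable_altSum₄_term p q r t k).differentiableOn) Metric.isOpen_ball
    hle (z := s) (by simp)
  simp only [deriv_const_mul_field, deriv_comp_add_const] at this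
  exact this

theorem altSum₄_eq {p q r t : ℂ} (h : 3 < (p + q + r + t).re) (s : ℂ) :
    altSum₄ p q r t s = altSum₄ p q r t 0 * Complex.cos (Real.pi * s) +
      altSum₄ p q r t (1 / 2) * Complex.sin (Real.pi * s) := by
  obtain ⟨M, Y, u, hu, hle⟩ := exists_summable_bound_strip h
  refine eq_of_antiperiodic_of_norm_le (differentiable_altSum₄ h) (altSum₄_add_one p q r t)
    (C := ∑' k, u k) (M := M) (Y := Y) (fun s hs hY => ?_) s
  rw [altSum₄, ← tsum_mul_right]
  exact tsum_of_norm_bounded (hu.mul_right _).hasSum fun k => hle s hs hY k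

theorem deriv_altSum₄_zero_mul_sin {p q r t : ℂ} (h : 3 < (p + q + r + t).re) (s : ℂ) :
    deriv (altSum₄ p q r t) 0 * Complex.sin (Real.pi * s) =
      Real.pi * (altSum₄ p q r t s - altSum₄ p q r t 0 * Complex.cos (Real.pi * s)) := by
  have h0 := ((hasDerivAt_id (0 : ℂ)).const_mul (Real.pi : ℂ))
  have h1 := (h0.ccos.const_mul (altSum₄ p q r t 0)).add
    (h0.csin.const_mul (altSum₄ p q r t (1 / 2)))
  have h2 : deriv (altSum₄ p q r t) 0 = altSum₄ p q r t (1 / 2) * Real.pi := by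
    refine (h1.congr_of_eventuallyEq (Filter.Eventually.of_forall (altSum₄_eq h))).deriv.trans ?_
    simp
  rw [h2, altSum₄_eq h s]
  ring

theorem rf_zero (x : ℂ) : rf x 0 = 1 := by simp [rf]

theorem rf_succ (x : ℂ) (n : ℕ) : rf x (n + 1) = rf x n * (x + n) := by
  simp [rf, Finset.prod_range_succ]

theorem rf_one (n : ℕ) : rf 1 n = (n.factorial : ℂ) := by
  induction n with
  | zero => simp [rf_zero]
  | succ n ih =>
    rw [rf_succ, ih, Nat.factorial_succ]
    push_cast
    ring

theorem rf_ne_zero {x : ℂ} (hx : ∀ m : ℕ, x ≠ -m) (n : ℕ) : rf x n ≠ 0 :=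
  Finset.prod_ne_zero_iff.2 fun j _ h => hx j (eq_neg_of_add_eq_zero_left h)

theorem exists_norm_inv_GammaSeq_le (x : ℂ) : ∃ C, ∀ n : ℕ, ‖(GammaSeq x n)⁻¹‖ ≤ C := by
  suffices ∃ l, Tendsto (fun n => (GammaSeq x n)⁻¹) atTop (𝓝 l) by
    obtain ⟨l, hl⟩ := this
    obtain ⟨C, hC⟩ := hl.norm.bddAbove_range
    exact ⟨C, fun n => hC ⟨n, rfl⟩⟩
  by_cases hx : ∀ m : ℕ, x ≠ -m
  · exact ⟨_, (GammaSeq_tendsto_Gamma x).inv₀ (Gamma_ne_zero hx)⟩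
  · push Not at hx
    obtain ⟨m, hm⟩ := hx
    refine ⟨0, tendsto_const_nhds.congr' ?_⟩
    filter_upwards [eventually_ge_atTop m] with n hn
    have : ∏ j ∈ Finset.range (n + 1), (x + j) = 0 :=
      Finset.prod_eq_zero (Finset.mem_range.2 (Nat.lt_succ_of_le hn)) (by simp [hm])
    simp [GammaSeq, this]

theorem summable_norm_rf_mul_rf_div {p q r t : ℂ} (h : 1 < (r + t - p - q).re) :
    Summable fun k : ℕ => ‖rf p k * rf q k / (rf r k * rf t k)‖ := by
  obtain ⟨P, hP⟩ := exists_norm_inv_GammaSeq_le p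
  obtain ⟨Q, hQ⟩ := exists_norm_inv_GammaSeq_le q
  obtain ⟨R, hR⟩ := (GammaSeq_tendsto_Gamma r).norm.bddAbove_range
  obtain ⟨T, hT⟩ := (GammaSeq_tendsto_Gamma t).norm.bddAbove_range
  rw [← summable_nat_add_iff 1]
  refine Summable.of_norm_bounded_eventually_nat
    ((Real.summable_nat_rpow (p := -(r + t - p - q).re)).2
      (by linarith) |>.mul_left (P * Q * R * T)) ?_
  filter_upwards [eventually_gt_atTop 0] with n hn
  have hn0 : (n : ℂ) ≠ 0 := by exact_mod_cast hn.ne'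
  have hrf : ∀ x, rf x (n + 1) = (n : ℂ) ^ x * n.factorial * (GammaSeq x n)⁻¹ := by
    intro x
    have h1 : (n : ℂ) ^ x ≠ 0 := by simp [Complex.cpow_eq_zero_iff, hn0]
    have h2 : (n.factorial : ℂ) ≠ 0 := by exact_mod_cast n.factorial_ne_zero
    rw [GammaSeq, inv_div, mul_div_cancel₀ _ (mul_ne_zero h1 h2), rf]
  have hfac : (n.factorial : ℂ) ≠ 0 := by exact_mod_cast n.factorial_ne_zero
  have e : rf p (n + 1) * rf q (n + 1) / (rf r (n + 1) * rf t (n + 1)) =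
      (GammaSeq p n)⁻¹ * (GammaSeq q n)⁻¹ * GammaSeq r n * GammaSeq t n *
        (n : ℂ) ^ (-(r + t - p - q)) := by
    have hpow : (n : ℂ) ^ (-(r + t - p - q)) =
        (n : ℂ) ^ p * (n : ℂ) ^ q / ((n : ℂ) ^ r * (n : ℂ) ^ t) := by
      rw [← Complex.cpow_add _ _ hn0, ← Complex.cpow_add _ _ hn0, ← Complex.cpow_sub _ _ hn0]
      congr 1
      ring
    rw [hpow, hrf, hrf, hrf, hrf]
    field_simp
  rw [norm_norm, e, norm_mul, norm_mul, norm_mul, norm_mul, Complex.norm_natCast_cpow_of_pos hn,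
    neg_re]
  have hP0 := (norm_nonneg _).trans (hP 0)
  have hQ0 := (norm_nonneg _).trans (hQ 0)
  have hR0 : 0 ≤ R := (norm_nonneg _).trans (hR ⟨0, rfl⟩)
  gcongr
  · exact hP n
  · exact hQ n
  · exact hR ⟨n, rfl⟩
  · exact hT ⟨n, rfl⟩

theorem inv_Gamma_add_nat {x : ℂ} (hx : ∀ m : ℕ, x ≠ -m) (n : ℕ) :
    (Gamma (x + n))⁻¹ = (Gamma x)⁻¹ / rf x n := by
  induction n with
  | zero => simp [rf_zero]
  | succ n ih =>
    have h := one_div_Gamma_eq_self_mul_one_div_Gamma_add_one (x + n)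
    have h0 : x + n ≠ 0 := fun h => hx n (eq_neg_of_add_eq_zero_left h)
    rw [ih] at h
    rw [rf_succ, ← div_div, h, Nat.cast_succ, ← add_assoc]
    field_simp

theorem inv_Gamma_sub_nat (x : ℂ) (n : ℕ) :
    (Gamma (x - n))⁻¹ = (Gamma x)⁻¹ * ((-1) ^ n * rf (1 - x) n) := by
  induction n with
  | zero => simp [rf_zero]
  | succ n ih =>
    rw [one_div_Gamma_eq_self_mul_one_div_Gamma_add_one, Nat.cast_succ,
      show x - ((n : ℂ) + 1) + 1 = x - n by ring, ih, rf_succ]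
    ring

theorem deriv_inv_Gamma_neg_nat (n : ℕ) :
    deriv (fun s => (Gamma s)⁻¹) (-n) = (-1) ^ n * (n.factorial : ℂ) := by
  have hrec : ∀ s : ℂ, deriv (fun s => (Gamma s)⁻¹) s =
      (Gamma (s + 1))⁻¹ + s * deriv (fun s => (Gamma s)⁻¹) (s + 1) := by
    intro s
    have h1 := (differentiable_one_div_Gamma (s + 1)).hasDerivAt.comp_add_const s 1
    have h2 := (hasDerivAt_id s).mul h1
    refine (h2.congr_of_eventuallyEq (Filter.Eventually.of_forall
      one_div_Gamma_eq_self_mul_one_div_Gamma_add_one)).deriv.trans ?_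
    simp
  induction n with
  | zero => rw [hrec]; simp
  | succ n ih =>
    rw [hrec, show -((n + 1 : ℕ) : ℂ) + 1 = -n by push_cast; ring, ih, Gamma_neg_nat_eq_zero,
      Nat.factorial_succ]
    push_cast
    ring

theorem hasDerivAt_inv_Gamma {s : ℂ} (hs : ∀ m : ℕ, s ≠ -m) :
    HasDerivAt (fun s => (Gamma s)⁻¹) (-ψ s * (Gamma s)⁻¹) s := by
  refine ((differentiableAt_Gamma s hs).hasDerivAt.inv (Gamma_ne_zero hs)).congr_deriv ?_
  simp only [ψ]
  field_simp

theorem ψ_one_sub {z : ℂ} (hz : ∀ n : ℤ, z ≠ n) :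
    ψ (1 - z) = ψ z + Real.pi * Complex.cot (Real.pi * z) := by
  have hz1 : ∀ m : ℕ, z ≠ -m := fun m h => hz (-m) (by simpa using h)
  have hz2 : ∀ m : ℕ, 1 - z ≠ -m := fun m h => hz (m + 1) (by
    push_cast
    linear_combination -h)
  have hs : Complex.sin (Real.pi * z) ≠ 0 := by
    rw [Ne, Complex.sin_eq_zero_iff]
    rintro ⟨k, hk⟩
    refine hz k (mul_left_cancel₀ (ofReal_ne_zero.2 Real.pi_ne_zero) (hk.trans (mul_comm _ _)))
  have hG := (differentiableAt_Gamma z hz1).hasDerivAt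
  have hG' := (differentiableAt_Gamma (1 - z) hz2).hasDerivAt.comp_const_sub 1 z
  have hsin := ((hasDerivAt_id z).const_mul (Real.pi : ℂ)).csin
  have h1 := ((hG.mul hG').mul hsin).congr_of_eventuallyEq
    (f₁ := fun w => Gamma w * Gamma (1 - w) * Complex.sin (Real.pi * w))
    (Filter.Eventually.of_forall fun _ => rfl)
  have h2 : (fun w => Gamma w * Gamma (1 - w) * Complex.sin (Real.pi * w)) =ᶠ[𝓝 z]
      fun _ => (Real.pi : ℂ) := by
    have : ContinuousAt (fun w : ℂ => Complex.sin (Real.pi * w)) z := by fun_prop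
    filter_upwards [this.eventually_ne hs] with w hw
    rw [Complex.Gamma_mul_Gamma_one_sub, div_mul_cancel₀ _ hw]
  have h3 := h1.unique ((hasDerivAt_const z (Real.pi : ℂ)).congr_of_eventuallyEq h2)
  have g1 := Gamma_ne_zero hz1
  have g2 := Gamma_ne_zero hz2
  simp only [id, Pi.mul_apply] at h3
  rw [ψ, ψ, Complex.cot]
  generalize Complex.sin (Real.pi * z) = S at *
  generalize Complex.cos (Real.pi * z) = T at *
  field_simp
  linear_combination -h3

theorem cot_pi_mul_add_nat (z : ℂ) (n : ℕ) :
    Complex.cot (Real.pi * (z + n)) = Complex.cot (Real.pi * z) := by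
  rw [Complex.cot, Complex.cot, mul_add, mul_comm (Real.pi : ℂ) n,
    Complex.cos_antiperiodic.add_nat_mul_eq, Complex.sin_antiperiodic.add_nat_mul_eq,
    mul_div_mul_left _ _ (pow_ne_zero n (by norm_num))]

theorem deriv_recipGamma₄ {p q r t z : ℂ} (hp : ∀ m : ℕ, p - z ≠ -m) (hq : ∀ m : ℕ, q - z ≠ -m)
    (hr : ∀ m : ℕ, r + z ≠ -m) (ht : ∀ m : ℕ, t + z ≠ -m) :
    deriv (recipGamma₄ p q r t) z =
      recipGamma₄ p q r t z * (ψ (p - z) + ψ (q - z) - ψ (r + z) - ψ (t + z)) := by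
  have h := ((((hasDerivAt_inv_Gamma hp).comp_const_sub p z).mul
    ((hasDerivAt_inv_Gamma hq).comp_const_sub q z)).mul
    ((hasDerivAt_inv_Gamma hr).comp_const_add r z)).mul
    ((hasDerivAt_inv_Gamma ht).comp_const_add t z)
  refine (h.congr_of_eventuallyEq (Filter.Eventually.of_forall fun _ => rfl)).deriv.trans ?_
  simp only [recipGamma₄, Pi.mul_apply]
  ring

theorem deriv_recipGamma₄_neg_nat (p q r : ℂ) (n : ℕ) :
    deriv (recipGamma₄ p q r 1) (-(n + 1)) =
      (Gamma (p + 1 + n))⁻¹ * (Gamma (q + 1 + n))⁻¹ * (Gamma (r - 1 - n))⁻¹ *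
        ((-1) ^ n * n.factorial) := by
  have hd := (differentiable_one_div_Gamma (1 + -((n : ℂ) + 1))).hasDerivAt.comp_const_add 1
    (-((n : ℂ) + 1))
  have hF : DifferentiableAt ℂ
      (fun z => (Gamma (p - z))⁻¹ * (Gamma (q - z))⁻¹ * (Gamma (r + z))⁻¹) (-((n : ℂ) + 1)) :=
    (((differentiable_one_div_Gamma.comp (differentiable_id.const_sub p)).mul
    (differentiable_one_div_Gamma.comp (differentiable_id.const_sub q))).mul
    (differentiable_one_div_Gamma.comp (differentiable_id.const_add r))) _
  refine ((hF.hasDerivAt.mul hd).congr_of_eventuallyEq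
    (Filter.Eventually.of_forall fun _ => rfl)).deriv.trans ?_
  rw [show (1 : ℂ) + -((n : ℂ) + 1) = -n by ring, deriv_inv_Gamma_neg_nat, Gamma_neg_nat_eq_zero,
    show p - -((n : ℂ) + 1) = p + 1 + n by ring, show q - -((n : ℂ) + 1) = q + 1 + n by ring,
    show r + -((n : ℂ) + 1) = r - 1 - n by ring]
  simp

theorem recipGamma₄_add_nat {p q r t z : ℂ} (hr : ∀ m : ℕ, r + z ≠ -m) (ht : ∀ m : ℕ, t + z ≠ -m)
    (n : ℕ) :
    recipGamma₄ p q r t (z + n) = recipGamma₄ p q r t z *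
      (rf (1 - p + z) n * rf (1 - q + z) n / (rf (r + z) n * rf (t + z) n)) := by
  rw [recipGamma₄, recipGamma₄, ← sub_sub, ← sub_sub, inv_Gamma_sub_nat, inv_Gamma_sub_nat,
    ← add_assoc, ← add_assoc, inv_Gamma_add_nat hr, inv_Gamma_add_nat ht,
    show 1 - (p - z) = 1 - p + z by ring, show 1 - (q - z) = 1 - q + z by ring]
  have : ((-1 : ℂ) ^ n) * (-1) ^ n = 1 := by rw [← mul_pow]; norm_num
  have hr0 := rf_ne_zero hr n
  have ht0 := rf_ne_zero ht n
  field_simp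
  rw [pow_two, this, one_mul]

theorem altSum₄_eq_tsum_nat {p q r t z : ℂ}
    (h : ∀ n : ℕ, recipGamma₄ p q r t (z - (n + 1)) = 0) :
    altSum₄ p q r t z = ∑' n : ℕ, (-1 : ℂ) ^ n * recipGamma₄ p q r t (z + n) := by
  rw [altSum₄, ← (Nat.cast_injective (R := ℤ)).tsum_eq]
  · simp
  · intro k hk
    rcases k with n | n
    · exact ⟨n, rfl⟩
    · refine absurd ?_ hk
      have := h n
      simp only [Int.cast_negSucc, Nat.cast_add, Nat.cast_one, ← sub_eq_add_neg, this, mul_zero]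

theorem recipGamma₄_natCast {a b c : ℂ} (hc : ∀ n : ℤ, c ≠ n) (n : ℕ) :
    recipGamma₄ (1 - a) (1 - b) c 1 n = recipGamma₄ (1 - a) (1 - b) c 1 0 *
      (rf a n * rf b n / (rf c n * n.factorial)) := by
  have h := recipGamma₄_add_nat (p := 1 - a) (q := 1 - b) (r := c) (t := 1) (z := 0)
    (fun m h => hc (-m) (by simpa using h))
    (fun m h => by
      rw [add_zero, eq_neg_iff_add_eq_zero] at h
      exact Nat.cast_add_one_ne_zero (R := ℂ) m (by rw [add_comm]; exact h)) n
  simpa only [zero_add, add_zero, sub_sub_cancel, rf_one] using h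

theorem deriv_recipGamma₄_natCast {a b c : ℂ} (ha : ∀ n : ℤ, a ≠ n) (hb : ∀ n : ℤ, b ≠ n)
    (hc : ∀ n : ℤ, c ≠ n) (n : ℕ) :
    deriv (recipGamma₄ (1 - a) (1 - b) c 1) n =
      recipGamma₄ (1 - a) (1 - b) c 1 0 * (rf a n * rf b n / (rf c n * n.factorial)) *
        (Real.pi * (Complex.cot (Real.pi * a) + Complex.cot (Real.pi * b)) -
          (ψ (c + n) + ψ (1 + n) - ψ (a + n) - ψ (b + n))) := by
  have hadd : ∀ {x : ℂ}, (∀ m : ℤ, x ≠ m) → ∀ m : ℤ, x + n ≠ m := fun hx m h =>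
    hx (m - n) (by push_cast; exact eq_sub_of_add_eq h)
  have hsub : ∀ {x : ℂ}, (∀ m : ℤ, x ≠ m) → ∀ m : ℕ, 1 - x - n ≠ -m := fun hx m h =>
    hx (1 - n + m) (by
      push_cast
      linear_combination -h)
  rw [deriv_recipGamma₄ (hsub ha) (hsub hb) (fun m h => hadd hc (-m) (by simpa using h))
      (fun m h => by
        rw [eq_neg_iff_add_eq_zero] at h
        exact Nat.cast_add_one_ne_zero (R := ℂ) (n + m) (by push_cast; linear_combination h)),
    recipGamma₄_natCast hc, sub_sub 1 a, sub_sub 1 b, ψ_one_sub (hadd ha), ψ_one_sub (hadd hb),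
    cot_pi_mul_add_nat, cot_pi_mul_add_nat]
  ring

theorem deriv_recipGamma₄_neg_nat_sub_one {a b c : ℂ} (ha : ∀ n : ℤ, a ≠ n) (hb : ∀ n : ℤ, b ≠ n)
    (n : ℕ) :
    deriv (recipGamma₄ (1 - a) (1 - b) c 1) (-(n + 1)) =
      (Gamma (2 - a))⁻¹ * (Gamma (2 - b))⁻¹ * (Gamma (c - 1))⁻¹ *
        (n.factorial * rf (2 - c) n / (rf (2 - a) n * rf (2 - b) n)) := by
  have hsub : ∀ {x : ℂ}, (∀ m : ℤ, x ≠ m) → ∀ m : ℕ, 2 - x ≠ -m := fun hx m h =>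
    hx (2 + m) (by
      push_cast
      linear_combination -h)
  have hn : ((-1 : ℂ) ^ n) * (-1) ^ n = 1 := by rw [← mul_pow]; norm_num
  rw [deriv_recipGamma₄_neg_nat, show 1 - a + 1 = 2 - a by ring, show 1 - b + 1 = 2 - b by ring,
    inv_Gamma_add_nat (hsub ha), inv_Gamma_add_nat (hsub hb), inv_Gamma_sub_nat,
    show 1 - (c - 1) = 2 - c by ring]
  linear_combination ((Gamma (2 - a))⁻¹ * (Gamma (2 - b))⁻¹ * (Gamma (c - 1))⁻¹ *
        (n.factorial * rf (2 - c) n / (rf (2 - a) n * rf (2 - b) n))) * hn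

theorem altSum₄_zero {a b c : ℂ} (hc : ∀ n : ℤ, c ≠ n) :
    altSum₄ (1 - a) (1 - b) c 1 0 = recipGamma₄ (1 - a) (1 - b) c 1 0 *
      ∑' k : ℕ, rf a k * rf b k * (-1 : ℂ) ^ k / (rf c k * (Nat.factorial k : ℂ)) := by
  rw [altSum₄_eq_tsum_nat, ← tsum_mul_left]
  · refine tsum_congr fun k => ?_
    rw [zero_add, recipGamma₄_natCast hc]
    ring
  · intro n
    rw [recipGamma₄, show (1 : ℂ) + (0 - (n + 1)) = -n by ring, Gamma_neg_nat_eq_zero, inv_zero,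
      mul_zero]

theorem altSum₄_one_sub {a b c : ℂ} (hc : ∀ n : ℤ, c ≠ n) :
    altSum₄ (1 - a) (1 - b) c 1 (1 - c) =
      (Gamma (c - a))⁻¹ * (Gamma (c - b))⁻¹ * (Gamma (2 - c))⁻¹ *
      ∑' k : ℕ, rf (1 - c + a) k * rf (1 - c + b) k * (-1 : ℂ) ^ k /
        (rf (2 - c) k * (Nat.factorial k : ℂ)) := by
  rw [altSum₄_eq_tsum_nat, ← tsum_mul_left]
  · refine tsum_congr fun k => ?_
    rw [recipGamma₄_add_nat
      (fun m h => by
        rw [add_sub_cancel, eq_neg_iff_add_eq_zero] at h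
        exact Nat.cast_add_one_ne_zero (R := ℂ) m (by rw [add_comm]; exact h))
      (fun m h => hc (2 + m) (by
        push_cast
        linear_combination -h)),
      recipGamma₄, add_sub_cancel, rf_one, Gamma_one, show 1 - a - (1 - c) = c - a by ring,
      show 1 - b - (1 - c) = c - b by ring, show 1 + (1 - c) = 2 - c by ring,
      show 1 - (1 - a) + (1 - c) = 1 - c + a by ring,
      show 1 - (1 - b) + (1 - c) = 1 - c + b by ring]
    ring
  · intro n
    rw [recipGamma₄, show c + (1 - c - (n + 1)) = -n by ring, Gamma_neg_nat_eq_zero, inv_zero,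
      mul_zero, zero_mul]

theorem summable_norm_rf_mul_rf_mul_neg_one_pow_div {p q r t : ℂ} (h : 1 < (r + t - p - q).re) :
    Summable fun k : ℕ => ‖rf p k * rf q k * (-1) ^ k / (rf r k * rf t k)‖ :=
  (summable_norm_rf_mul_rf_div h).congr fun k => by simp

theorem stmt11 (a b c : ℂ)
    (ha : ∀ n : ℤ, a ≠ n) (hb : ∀ n : ℤ, b ≠ n) (hc : ∀ n : ℤ, c ≠ n)
    (hre : 0 < (c - a - b).re) :
    Summable (fun k : ℕ => ‖rf a k * rf b k * (-1 : ℂ) ^ k /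
        (rf c k * (Nat.factorial k : ℂ)) *
        (ψ (c + k) + ψ (1 + k) - ψ (a + k) - ψ (b + k))‖) ∧
    Summable (fun k : ℕ => ‖rf a k * rf b k * (-1 : ℂ) ^ k /
        (rf c k * (Nat.factorial k : ℂ))‖) ∧
    Summable (fun k : ℕ => ‖(Nat.factorial k : ℂ) * rf (2 - c) k * (-1 : ℂ) ^ k /
        (rf (2 - a) k * rf (2 - b) k)‖) ∧
    Summable (fun k : ℕ => ‖rf (1 - c + a) k * rf (1 - c + b) k * (-1 : ℂ) ^ k /
        (rf (2 - c) k * (Nat.factorial k : ℂ))‖) ∧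
    (∑' k : ℕ, rf a k * rf b k * (-1 : ℂ) ^ k / (rf c k * (Nat.factorial k : ℂ)) *
        (ψ (c + k) + ψ (1 + k) - ψ (a + k) - ψ (b + k))) =
      (Real.pi : ℂ) * (Complex.cot ((Real.pi : ℂ) * a) + Complex.cot ((Real.pi : ℂ) * b) -
          Complex.cot ((Real.pi : ℂ) * c)) *
        (∑' k : ℕ, rf a k * rf b k * (-1 : ℂ) ^ k / (rf c k * (Nat.factorial k : ℂ))) +
      ((1 - c) / ((1 - a) * (1 - b))) *
        (∑' k : ℕ, (Nat.factorial k : ℂ) * rf (2 - c) k * (-1 : ℂ) ^ k /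
          (rf (2 - a) k * rf (2 - b) k)) +
      ((Real.pi : ℂ) * Complex.Gamma (1 - a) * Complex.Gamma (1 - b) * Complex.Gamma (c - 1) /
          (Complex.Gamma (1 - c) * Complex.sin ((Real.pi : ℂ) * c) *
            Complex.Gamma (c - a) * Complex.Gamma (c - b))) *
        (∑' k : ℕ, rf (1 - c + a) k * rf (1 - c + b) k * (-1 : ℂ) ^ k /
          (rf (2 - c) k * (Nat.factorial k : ℂ))) := by
  simp only [sub_re] at hre
  have hP : 3 < (1 - a + (1 - b) + c + 1).re := by
    simp only [sub_re, add_re, one_re]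
    linarith
  have hS₂ : Summable fun k : ℕ => ‖rf a k * rf b k * (-1 : ℂ) ^ k / (rf c k * k.factorial)‖ := by
    simp only [← rf_one]
    refine summable_norm_rf_mul_rf_mul_neg_one_pow_div ?_
    simp only [sub_re, add_re, one_re]
    linarith
  have hS₃ : Summable fun k : ℕ =>
      ‖(k.factorial : ℂ) * rf (2 - c) k * (-1 : ℂ) ^ k / (rf (2 - a) k * rf (2 - b) k)‖ := by
    simp only [← rf_one]
    refine summable_norm_rf_mul_rf_mul_neg_one_pow_div ?_
    simp only [sub_re, one_re, re_ofNat, add_re]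
    linarith
  have hS₄ : Summable fun k : ℕ =>
      ‖rf (1 - c + a) k * rf (1 - c + b) k * (-1 : ℂ) ^ k / (rf (2 - c) k * k.factorial)‖ := by
    simp only [← rf_one]
    refine summable_norm_rf_mul_rf_mul_neg_one_pow_div ?_
    simp only [sub_re, add_re, one_re, re_ofNat]
    linarith
  have hGamma : ∀ {x : ℂ}, (∀ n : ℤ, x ≠ n) → Gamma (1 - x) ≠ 0 := fun hx =>
    Gamma_ne_zero fun m h => hx (1 + m) (by
      push_cast
      linear_combination -h)
  have hne : ∀ {x : ℂ}, (∀ n : ℤ, x ≠ n) → 1 - x ≠ 0 := fun hx =>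
    sub_ne_zero.2 fun h => hx 1 (by simpa using h.symm)
  have hrec : ∀ {x : ℂ}, (∀ n : ℤ, x ≠ n) → Gamma (2 - x) = (1 - x) * Gamma (1 - x) := fun hx => by
    rw [← Gamma_add_one _ (hne hx)]
    ring_nf
  have hc1 : c - 1 ≠ 0 := sub_ne_zero.2 fun h => hc 1 (by simpa using h)
  have hGc : Gamma c = (c - 1) * Gamma (c - 1) := by
    rw [← Gamma_add_one _ hc1, sub_add_cancel]
  have ha1 := hne ha
  have hb1 := hne hb
  have hc2 := hne hc
  have hGa : Gamma (1 - a) ≠ 0 := hGamma ha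
  have hGb : Gamma (1 - b) ≠ 0 := hGamma hb
  have hGc1 : Gamma (1 - c) ≠ 0 := hGamma hc
  have hGc2 : Gamma (c - 1) ≠ 0 := Gamma_ne_zero fun m h => hc (1 - m) (by
    push_cast
    linear_combination h)
  have hl : recipGamma₄ (1 - a) (1 - b) c 1 0 =
      (Gamma (1 - a))⁻¹ * (Gamma (1 - b))⁻¹ * ((c - 1) * Gamma (c - 1))⁻¹ := by
    simp [recipGamma₄, ← hGc]
  have hl0 : recipGamma₄ (1 - a) (1 - b) c 1 0 ≠ 0 := by
    rw [hl]
    positivity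
  have hE := hasSum_deriv_altSum₄ hP 0
  have hT : (fun k : ℕ => rf a k * rf b k * (-1 : ℂ) ^ k / (rf c k * k.factorial) *
      (ψ (c + k) + ψ (1 + k) - ψ (a + k) - ψ (b + k))) = fun k : ℕ =>
      Real.pi * (Complex.cot (Real.pi * a) + Complex.cot (Real.pi * b)) *
        (rf a k * rf b k * (-1 : ℂ) ^ k / (rf c k * k.factorial)) -
      (recipGamma₄ (1 - a) (1 - b) c 1 0)⁻¹ *
        ((-1 : ℂ) ^ (k : ℤ) * deriv (recipGamma₄ (1 - a) (1 - b) c 1) (0 + (k : ℤ))) := by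
    funext k
    rw [Int.cast_natCast, zero_add, deriv_recipGamma₄_natCast ha hb hc, zpow_natCast]
    field_simp
    ring
  have hN : Summable fun k : ℕ =>
      (-1 : ℂ) ^ (k : ℤ) * deriv (recipGamma₄ (1 - a) (1 - b) c 1) (0 + (k : ℤ)) :=
    hE.summable.comp_injective Nat.cast_injective
  have hneg : (fun k : ℕ => (-1 : ℂ) ^ (-((k : ℤ) + 1)) *
      deriv (recipGamma₄ (1 - a) (1 - b) c 1) (0 + (-((k : ℤ) + 1) : ℤ))) = fun k : ℕ =>
      -((Gamma (2 - a))⁻¹ * (Gamma (2 - b))⁻¹ * (Gamma (c - 1))⁻¹) *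
      (k.factorial * rf (2 - c) k * (-1 : ℂ) ^ k / (rf (2 - a) k * rf (2 - b) k)) := by
    funext k
    push_cast
    rw [zero_add, deriv_recipGamma₄_neg_nat_sub_one ha hb, zpow_neg, ← inv_zpow,
      zpow_add_one₀ (by norm_num), zpow_natCast, inv_neg_one]
    ring
  have hsum := hE.unique (hN.hasSum.of_nat_of_neg_add_one
    (by rw [hneg]; exact (hS₃.of_norm.mul_left _).hasSum))
  have hmain := deriv_altSum₄_zero_mul_sin hP (1 - c)
  have hsin0 : Complex.sin (Real.pi * c) ≠ 0 := by
    rw [Ne, Complex.sin_eq_zero_iff]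
    rintro ⟨k, hk⟩
    exact hc k (mul_left_cancel₀ (ofReal_ne_zero.2 Real.pi_ne_zero) (hk.trans (mul_comm _ _)))
  rw [mul_sub, mul_one, Complex.sin_pi_sub, Complex.cos_pi_sub, altSum₄_zero hc,
    altSum₄_one_sub hc, hsum, tsum_mul_left] at hmain
  refine ⟨?_, hS₂, hS₃, hS₄, ?_⟩
  · refine Summable.norm ?_
    rw [hT]
    exact ((hS₂.of_norm.mul_left _).sub (hN.mul_left _))
  · rw [hT, (hS₂.of_norm.mul_left _).tsum_sub (hN.mul_left _), tsum_mul_left, tsum_mul_left]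
    rw [hrec ha, hrec hb, hrec hc, hl] at hmain
    rw [hl, Complex.cot.eq_1 (Real.pi * c)]
    generalize (∑' k : ℕ, rf a k * rf b k * (-1 : ℂ) ^ k / (rf c k * k.factorial)) = S₂ at *
    generalize (∑' k : ℕ, k.factorial * rf (2 - c) k * (-1 : ℂ) ^ k /
      (rf (2 - a) k * rf (2 - b) k)) = S₃ at *
    generalize (∑' k : ℕ, rf (1 - c + a) k * rf (1 - c + b) k * (-1 : ℂ) ^ k /
      (rf (2 - c) k * k.factorial)) = S₄ at *
    generalize (∑' k : ℕ, (-1 : ℂ) ^ (k : ℤ) *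
      deriv (recipGamma₄ (1 - a) (1 - b) c 1) (0 + (k : ℤ))) = X at *
    rw [← div_div _ _ (Gamma (c - b)), ← div_div _ _ (Gamma (c - a)),
      div_eq_mul_inv _ (Gamma (c - b)), div_eq_mul_inv _ (Gamma (c - a))]
    generalize (Gamma (c - a))⁻¹ = U at *
    generalize (Gamma (c - b))⁻¹ = V at *
    generalize Complex.sin (Real.pi * c) = S at *
    generalize Complex.cos (Real.pi * c) = C at *
    generalize Gamma (c - 1) = G at *
    rw [← neg_sub 1 c] at hmain ⊢
    have hX := eq_div_of_mul_eq hsin0 hmain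
    rw [eq_sub_of_add_eq hX]
    field_simp
    ring
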